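/- arXiv:2604.15346 — 10 statements merged into one kernel-verified Lean document; each statement's English description precedes it below -/
import Mathlib

section
/- If (V,ϱ,μ) is a representation of an almost Poisson algebra (A,[·,·],·) with V finite-dimensional, then (V*, ϱ*, −μ*) is also a representation of (A,[·,·],·), where for a linear map θ : A → End(V) the dual map θ* : A → End(V*) is defined by ⟨θ*(x)ξ, v⟩ = −⟨ξ, θ(x)v⟩ for all x ∈ A, ξ ∈ V*, v ∈ V. -/
def IsBilin (K : Type*) [Field K] {A B C : Type*} [AddCommGroup A] [Module K A]
    [AddCommGroup B] [Module K B] [AddCommGroup C] [Module K C] (f : A → B → C) : Prop :=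
  (∀ a a' b, f (a + a') b = f a b + f a' b) ∧
  (∀ (c : K) (a : A) (b : B), f (c • a) b = c • f a b) ∧
  (∀ a b b', f a (b + b') = f a b + f a b') ∧
  (∀ (c : K) (a : A) (b : B), f a (c • b) = c • f a b)

def IsCommAssoc (K : Type*) [Field K] {A : Type*} [AddCommGroup A] [Module K A]
    (m : A → A → A) : Prop :=
  IsBilin K m ∧ (∀ x y, m x y = m y x) ∧ (∀ x y z, m (m x y) z = m x (m y z))

def IsAlmostPoisson (K : Type*) [Field K] {A : Type*} [AddCommGroup A] [Module K A]
    (br m : A → A → A) : Prop :=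
  IsCommAssoc K m ∧ IsBilin K br ∧ (∀ x y, br x y = - br y x) ∧
  (∀ x y z, br x (m y z) = m (br x y) z + m y (br x z))

/-- Representation of an almost Poisson algebra, with values in `Module.End`. -/
def IsAPRepEnd (K : Type*) [Field K] {A V : Type*} [AddCommGroup A] [Module K A]
    [AddCommGroup V] [Module K V] (br m : A → A → A)
    (ϱ μ : A → Module.End K V) : Prop :=
  IsLinearMap K ϱ ∧ IsLinearMap K μ ∧
  (∀ x y, μ (m x y) = μ x * μ y) ∧
  (∀ x y, ϱ (m x y) = μ y * ϱ x + μ x * ϱ y) ∧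
  (∀ x y, μ (br x y) = ϱ x * μ y - μ y * ϱ x)

/-- if `(V, ϱ, μ)` is a representation of an almost Poisson algebra, then
`(V*, ϱ*, −μ*)` is a representation, where `θ*(x) = -(θ x).dualMap`
(so `ϱ* x = -(ϱ x).dualMap` and `(−μ*) x = (μ x).dualMap`). -/
theorem stmt1 {K A V : Type*} [Field K] [CharZero K] [AddCommGroup A] [Module K A]
    [AddCommGroup V] [Module K V] [FiniteDimensional K V]
    (br m : A → A → A) (ϱ μ : A → Module.End K V)
    (hA : IsAlmostPoisson K br m) (hrep : IsAPRepEnd K br m ϱ μ) :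
    IsAPRepEnd K br m (fun x => -((ϱ x).dualMap)) (fun x => (μ x).dualMap) := by
  obtain ⟨⟨-, hc, -⟩, -, hs, -⟩ := hA
  obtain ⟨h1, h2, h3, h4, h5⟩ := hrep
  refine ⟨⟨?_, ?_⟩, ⟨?_, ?_⟩, ?_, ?_, ?_⟩
  · intro x y
    ext f v
    simp [h1.map_add]
    ring
  · intro c x
    ext f v
    simp [h1.map_smul]
  · intro x y
    ext f v
    simp [h2.map_add]
  · intro c x
    ext f v
    simp [h2.map_smul]
  · intro x y
    ext f v
    simp [hc x y, h3]
  · intro x y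
    have e : ϱ (m x y) = ϱ x * μ y + ϱ y * μ x := by
      have a := h5 x y
      have b := h5 y x
      rw [hs y x, h2.map_neg, a] at b
      rw [h4, ← sub_eq_zero]
      rw [← sub_eq_zero] at b
      rw [← b]
      abel
    ext f v
    simp [e]
    ring
  · intro x y
    ext f v
    simp [h5]
    try ring
end

section
/- Let (A₁,[·,·]₁,·₁) and (A₂,[·,·]₂,·₂) be almost Poisson algebras and ϱ₁,μ₁ : A₁ → End(A₂), ϱ₂,μ₂ : A₂ → End(A₁) linear maps. Define on A₁ ⊕ A₂ the operations (x₁+x₂)·(y₁+y₂) = x₁·₁y₁ + μ₂(x₂)y₁ + μ₂(y₂)x₁ + x₂·₂y₂ + μ₁(x₁)y₂ + μ₁(y₁)x₂ and [x₁+x₂, y₁+y₂] = [x₁,y₁]₁ + ϱ₂(x₂)y₁ − ϱ₂(y₂)x₁ + [x₂,y₂]₂ + ϱ₁(x₁)y₂ − ϱ₁(y₁)x₂. Then (A₁ ⊕ A₂, [·,·], ·) is an almost Poisson algebra if and only if (A₁, A₂, ϱ₁, μ₁, ϱ₂, μ₂) is a matched pair of almost Poisson algebras. -/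
/-- A matched pair of almost Poisson algebras. -/
def IsMatchedPair (K : Type*) [Field K] {A₁ A₂ : Type*} [AddCommGroup A₁] [Module K A₁]
    [AddCommGroup A₂] [Module K A₂]
    (br₁ m₁ : A₁ → A₁ → A₁) (br₂ m₂ : A₂ → A₂ → A₂)
    (ϱ₁ μ₁ : A₁ → A₂ → A₂) (ϱ₂ μ₂ : A₂ → A₁ → A₁) : Prop :=
  IsAlmostPoisson K br₁ m₁ ∧ IsAlmostPoisson K br₂ m₂ ∧
  IsBilin K ϱ₁ ∧ IsBilin K μ₁ ∧ IsBilin K ϱ₂ ∧ IsBilin K μ₂ ∧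
  (∀ x y a, μ₁ (m₁ x y) a = μ₁ x (μ₁ y a)) ∧
  (∀ x y a, μ₂ (m₂ x y) a = μ₂ x (μ₂ y a)) ∧
  (∀ x₁ x₂ y₂, μ₁ x₁ (m₂ x₂ y₂) = m₂ (μ₁ x₁ x₂) y₂ + μ₁ (μ₂ x₂ x₁) y₂) ∧
  (∀ x₂ x₁ y₁, μ₂ x₂ (m₁ x₁ y₁) = m₁ (μ₂ x₂ x₁) y₁ + μ₂ (μ₁ x₁ x₂) y₁) ∧
  (∀ x y a, ϱ₁ (m₁ x y) a = μ₁ y (ϱ₁ x a) + μ₁ x (ϱ₁ y a)) ∧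
  (∀ x y a, μ₁ (br₁ x y) a = ϱ₁ x (μ₁ y a) - μ₁ y (ϱ₁ x a)) ∧
  (∀ x y a, ϱ₂ (m₂ x y) a = μ₂ y (ϱ₂ x a) + μ₂ x (ϱ₂ y a)) ∧
  (∀ x y a, μ₂ (br₂ x y) a = ϱ₂ x (μ₂ y a) - μ₂ y (ϱ₂ x a)) ∧
  (∀ x₂ x₁ y₁, ϱ₂ x₂ (m₁ x₁ y₁) =
      m₁ (ϱ₂ x₂ x₁) y₁ + m₁ x₁ (ϱ₂ x₂ y₁) - μ₂ (ϱ₁ x₁ x₂) y₁ - μ₂ (ϱ₁ y₁ x₂) x₁) ∧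
  (∀ x₁ x₂ y₂, ϱ₁ x₁ (m₂ x₂ y₂) =
      m₂ (ϱ₁ x₁ x₂) y₂ + m₂ x₂ (ϱ₁ x₁ y₂) - μ₁ (ϱ₂ x₂ x₁) y₂ - μ₁ (ϱ₂ y₂ x₁) x₂) ∧
  (∀ x₁ x₂ y₁, br₁ x₁ (μ₂ x₂ y₁) - ϱ₂ (μ₁ y₁ x₂) x₁ =
      μ₂ (ϱ₁ x₁ x₂) y₁ - m₁ (ϱ₂ x₂ x₁) y₁ + μ₂ x₂ (br₁ x₁ y₁)) ∧
  (∀ x₂ x₁ y₂, br₂ x₂ (μ₁ x₁ y₂) - ϱ₁ (μ₂ y₂ x₁) x₂ =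
      μ₁ (ϱ₂ x₂ x₁) y₂ - m₂ (ϱ₁ x₁ x₂) y₂ + μ₁ x₁ (br₂ x₂ y₂))

set_option linter.unusedSimpArgs false

theorem aux {A B C : Type*} [AddCommGroup A] [AddCommGroup B] [AddCommGroup C] {f : A → B → C}
    (h : ∀ a a' b, f (a + a') b = f a b + f a' b) (h' : ∀ a b b', f a (b + b') = f a b + f a b') :
    (∀ b, f 0 b = 0) ∧ (∀ a, f a 0 = 0) ∧ (∀ a b, f (-a) b = - f a b) ∧ (∀ a b, f a (-b) = - f a b) ∧
    (∀ a a' b, f (a - a') b = f a b - f a' b) ∧ (∀ a b b', f a (b - b') = f a b - f a b') := by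
  refine ⟨fun b => ?_, fun a => ?_, fun a b => ?_, fun a b => ?_, fun a a' b => ?_, fun a b b' => ?_⟩
  · exact (AddMonoidHom.mk' (fun a => f a b) (fun x y => h x y b)).map_zero
  · exact (AddMonoidHom.mk' (f a) (h' a)).map_zero
  · exact (AddMonoidHom.mk' (fun a => f a b) (fun x y => h x y b)).map_neg a
  · exact (AddMonoidHom.mk' (f a) (h' a)).map_neg b
  · exact (AddMonoidHom.mk' (fun a => f a b) (fun x y => h x y b)).map_sub a a'
  · exact (AddMonoidHom.mk' (f a) (h' a)).map_sub b b'

/-- the direct sum operations make `A₁ ⊕ A₂` an almost Poisson algebra iff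
`(A₁, A₂, ϱ₁, μ₁, ϱ₂, μ₂)` is a matched pair of almost Poisson algebras. -/
theorem stmt2 {K A₁ A₂ : Type*} [Field K] [CharZero K] [AddCommGroup A₁] [Module K A₁]
    [AddCommGroup A₂] [Module K A₂]
    (br₁ m₁ : A₁ → A₁ → A₁) (br₂ m₂ : A₂ → A₂ → A₂)
    (ϱ₁ μ₁ : A₁ → A₂ → A₂) (ϱ₂ μ₂ : A₂ → A₁ → A₁)
    (h₁ : IsAlmostPoisson K br₁ m₁) (h₂ : IsAlmostPoisson K br₂ m₂)
    (hb₁ : IsBilin K ϱ₁) (hb₂ : IsBilin K μ₁) (hb₃ : IsBilin K ϱ₂) (hb₄ : IsBilin K μ₂) :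
    IsAlmostPoisson K
      (fun p q : A₁ × A₂ =>
        (br₁ p.1 q.1 + ϱ₂ p.2 q.1 - ϱ₂ q.2 p.1, br₂ p.2 q.2 + ϱ₁ p.1 q.2 - ϱ₁ q.1 p.2))
      (fun p q : A₁ × A₂ =>
        (m₁ p.1 q.1 + μ₂ p.2 q.1 + μ₂ q.2 p.1, m₂ p.2 q.2 + μ₁ p.1 q.2 + μ₁ q.1 p.2))
    ↔ IsMatchedPair K br₁ m₁ br₂ m₂ ϱ₁ μ₁ ϱ₂ μ₂ := by
  obtain ⟨⟨⟨ma, ms, ma', ms'⟩, mc, mas⟩, ⟨ba, bs, ba', bs'⟩, bsk, bl⟩ := id h₁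
  obtain ⟨⟨⟨na, ns, na', ns'⟩, nc, nas⟩, ⟨ca, cs, ca', cs'⟩, csk, cl⟩ := id h₂
  obtain ⟨ra, rs, ra', rs'⟩ := id hb₁
  obtain ⟨ua, us, ua', us'⟩ := id hb₂
  obtain ⟨sa, ss, sa', ss'⟩ := id hb₃
  obtain ⟨va, vs, va', vs'⟩ := id hb₄
  obtain ⟨mz, mz', mn, mn', md, md'⟩ := aux ma ma'
  obtain ⟨nz, nz', nn, nn', nd, nd'⟩ := aux na na'
  obtain ⟨bz, bz', bn, bn', bd, bd'⟩ := aux ba ba'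
  obtain ⟨cz, cz', cn, cn', cd, cd'⟩ := aux ca ca'
  obtain ⟨rz, rz', rn, rn', rd, rd'⟩ := aux ra ra'
  obtain ⟨uz, uz', un, un', ud, ud'⟩ := aux ua ua'
  obtain ⟨sz, sz', sn, sn', sd, sd'⟩ := aux sa sa'
  obtain ⟨vz, vz', vn, vn', vd, vd'⟩ := aux va va'
  constructor
  · rintro ⟨⟨-, -, as⟩, -, -, le⟩
    have as1 := fun x y z => congrArg Prod.fst (as x y z)
    have as2 := fun x y z => congrArg Prod.snd (as x y z)
    have le1 := fun x y z => congrArg Prod.fst (le x y z)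
    have le2 := fun x y z => congrArg Prod.snd (le x y z)
    clear as le
    simp only [Prod.fst_add, Prod.snd_add] at as1 as2 le1 le2
    refine ⟨h₁, h₂, hb₁, hb₂, hb₃, hb₄, ?_, ?_, ?_, ?_, ?_, ?_, ?_, ?_, ?_, ?_, ?_, ?_⟩
    · intro x y a
      have h := as2 (x, 0) (y, 0) (0, a)
      simp [mz, mz', nz, nz', uz, uz', vz, vz'] at h
      exact h
    · intro x y a
      have h := as1 (0, x) (0, y) (a, 0)
      simp [mz, mz', nz, nz', uz, uz', vz, vz'] at h
      exact h
    · intro x₁ x₂ y₂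
      have h := as2 (x₁, 0) (0, x₂) (0, y₂)
      simp [mz, mz', nz, nz', uz, uz', vz, vz'] at h
      exact h.symm
    · intro x₁ x₂ y₂
      have h := as1 (0, x₁) (x₂, 0) (y₂, 0)
      simp [mz, mz', nz, nz', uz, uz', vz, vz'] at h
      exact h.symm
    · intro x y a
      have h := le2 (0, a) (x, 0) (y, 0)
      simp [mz, mz', nz, nz', uz, uz', vz, vz', bz, bz', cz, cz', rz, rz', sz, sz', un, un', nn, nn'] at h
      linear_combination (norm := module) -h
    · intro x y a
      have h := le2 (x, 0) (y, 0) (0, a)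
      simp [mz, mz', nz, nz', uz, uz', vz, vz', bz, bz', cz, cz', rz, rz', sz, sz', un, un', nn, nn'] at h
      linear_combination (norm := module) -h
    · intro x y a
      have h := le1 (a, 0) (0, x) (0, y)
      simp [mz, mz', nz, nz', uz, uz', vz, vz', bz, bz', cz, cz', rz, rz', sz, sz', vn, vn', mn, mn'] at h
      linear_combination (norm := module) -h
    · intro x y a
      have h := le1 (0, x) (0, y) (a, 0)
      simp [mz, mz', nz, nz', uz, uz', vz, vz', bz, bz', cz, cz', rz, rz', sz, sz', vn, vn', mn, mn'] at h
      linear_combination (norm := module) -h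
    · intro x y a
      have h := le1 (0, x) (y, 0) (a, 0)
      simp [mz, mz', nz, nz', uz, uz', vz, vz', bz, bz', cz, cz', rz, rz', sz, sz', vn, vn', mn, mn'] at h
      linear_combination (norm := module) h
    · intro x y a
      have h := le2 (x, 0) (0, y) (0, a)
      simp [mz, mz', nz, nz', uz, uz', vz, vz', bz, bz', cz, cz', rz, rz', sz, sz', un, un', nn, nn'] at h
      linear_combination (norm := module) h
    · intro x y a
      have h := le1 (x, 0) (a, 0) (0, y)
      simp [mz, mz', nz, nz', uz, uz', vz, vz', bz, bz', cz, cz', rz, rz', sz, sz', vn, vn', mn, mn'] at h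
      linear_combination (norm := module) h - mc a (ϱ₂ y x)
    · intro x y a
      have h := le2 (0, x) (0, a) (y, 0)
      simp [mz, mz', nz, nz', uz, uz', vz, vz', bz, bz', cz, cz', rz, rz', sz, sz', un, un', nn, nn'] at h
      linear_combination (norm := module) h - nc a (ϱ₁ y x)
  · rintro ⟨-, -, -, -, -, -, e1, e2, e3, e4, e5, e6, e7, e8, e9, e10, e11, e12⟩
    have f1 : ∀ x y a, μ₁ x (μ₁ y a) = μ₁ y (μ₁ x a) := fun x y a => by
      rw [← e1, mc, e1]
    have f2 : ∀ x y a, μ₂ x (μ₂ y a) = μ₂ y (μ₂ x a) := fun x y a => by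
      rw [← e2, nc, e2]
    have g3 : ∀ a x y, μ₁ a (m₂ x y) = m₂ x (μ₁ a y) + μ₁ (μ₂ y a) x := fun a x y => by
      rw [nc, e3, nc]
    have g4 : ∀ a x y, μ₂ a (m₁ x y) = m₁ x (μ₂ a y) + μ₂ (μ₁ y a) x := fun a x y => by
      rw [mc, e4, mc]
    refine ⟨⟨⟨?_, ?_, ?_, ?_⟩, ?_, ?_⟩, ⟨?_, ?_, ?_, ?_⟩, ?_, ?_⟩
    · intro x y z
      ext <;> simp [ma, ma', na, na', ua, ua', va, va'] <;> abel
    · intro c x y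
      ext <;> simp [ms, ms', ns, ns', us, us', vs, vs']
    · intro x y z
      ext <;> simp [ma, ma', na, na', ua, ua', va, va'] <;> abel
    · intro c x y
      ext <;> simp [ms, ms', ns, ns', us, us', vs, vs']
    · intro x y
      ext <;> simp only
      · rw [mc]; abel
      · rw [nc]; abel
    · rintro ⟨x, x'⟩ ⟨y, y'⟩ ⟨z, z'⟩
      ext <;> simp only [ma, ma', na, na', ua, ua', va, va']
      · linear_combination (norm := module) mas x y z + e2 x' y' z + f2 z' x' y + f2 z' y' x - e2 y' z' x - e4 x' y z + g4 z' x y + g4 y' x z - e4 y' x z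
      · linear_combination (norm := module) nas x' y' z' + e1 x y z' + f1 z x y' + f1 z y x' - e1 y z x' - e3 x y' z' + g3 z x' y' + g3 y x' z' - e3 y x' z'
    · intro x y z
      ext <;> simp [ba, ba', ca, ca', ra, ra', sa, sa'] <;> abel
    · intro c x y
      ext <;> simp [bs, bs', cs, cs', rs, rs', ss, ss', smul_sub]
    · intro x y z
      ext <;> simp [ba, ba', ca, ca', ra, ra', sa, sa'] <;> abel
    · intro c x y
      ext <;> simp [bs, bs', cs, cs', rs, rs', ss, ss', smul_sub]
    · intro x y
      ext <;> simp only [Prod.fst_neg, Prod.snd_neg]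
      · rw [bsk]; abel
      · rw [csk]; abel
    · rintro ⟨x, x'⟩ ⟨y, y'⟩ ⟨z, z'⟩
      ext <;> simp only [Prod.fst_add, Prod.snd_add, ma, ma', na, na', ua, ua', va, va', ba, ba', ca, ca', ra, ra', sa, sa', md, md', nd, nd', ud, ud', vd, vd', bd, bd', cd, cd', rd, rd', sd, sd']
      · linear_combination (norm := module) bl x y z + e11 x z' y + mc y (ϱ₂ z' x) + e11 x y' z - e7 y' z' x + e9 x' y z - e8 x' y' z - e8 x' z' y
      · linear_combination (norm := module) cl x' y' z' + e12 x' z y' + nc y' (ϱ₁ z x') + e12 x' y z' - e5 y z x' + e10 x y' z' - e6 x y z' - e6 x z y'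
end

section
/- Let (A,[·,·]₁,·₁) be a finite-dimensional almost Poisson algebra and let (A*,[·,·]₂,·₂) be an almost Poisson algebra structure on its dual space. Then there is an almost Poisson algebra structure on A ⊕ A* making (A ⊕ A*, A, A*) a standard Manin triple of almost Poisson algebras with respect to the bilinear form ω_d(x+ξ, y+η) = ⟨x,η⟩ + ⟨ξ,y⟩ if and only if (A, A*, ad_A*, −L*, ad_{A*}*, −L_{A*}*) is a matched pair of almost Poisson algebras. -/
section helpers
variable {K A B : Type*} [Field K] [AddCommGroup A] [Module K A] [AddCommGroup B] [Module K B]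

def sumMul (m : A →ₗ[K] A →ₗ[K] A) (n : B →ₗ[K] B →ₗ[K] B) (u : A →ₗ[K] B →ₗ[K] B)
    (v : B →ₗ[K] A →ₗ[K] A) (p q : A × B) : A × B :=
  (m p.1 q.1 + v p.2 q.1 + v q.2 p.1, n p.2 q.2 + u p.1 q.2 + u q.1 p.2)

def sumBr (m : A →ₗ[K] A →ₗ[K] A) (n : B →ₗ[K] B →ₗ[K] B) (u : A →ₗ[K] B →ₗ[K] B)
    (v : B →ₗ[K] A →ₗ[K] A) (p q : A × B) : A × B :=
  (m p.1 q.1 + v p.2 q.1 - v q.2 p.1, n p.2 q.2 + u p.1 q.2 - u q.1 p.2)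

theorem bilin_lin {C : Type*} [AddCommGroup C] [Module K C] (f : A →ₗ[K] B →ₗ[K] C) :
    IsBilin K (fun x y => f x y) := by
  refine ⟨?_, ?_, ?_, ?_⟩ <;> intros <;> simp

theorem matched_of_sum (br m : A →ₗ[K] A →ₗ[K] A) (brD mD : B →ₗ[K] B →ₗ[K] B)
    (r u : A →ₗ[K] B →ₗ[K] B) (s v : B →ₗ[K] A →ₗ[K] A)
    (hA : IsAlmostPoisson K (fun x y => br x y) (fun x y => m x y))
    (hD : IsAlmostPoisson K (fun ξ η => brD ξ η) (fun ξ η => mD ξ η))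
    (h : IsAlmostPoisson K (sumBr br brD r s) (sumMul m mD u v)) :
    IsMatchedPair K (fun x y => br x y) (fun x y => m x y)
        (fun ξ η => brD ξ η) (fun ξ η => mD ξ η) (fun x y => r x y) (fun x y => u x y)
        (fun x y => s x y) (fun x y => v x y) := by
  obtain ⟨⟨_, _, has⟩, _, _, hl⟩ := h
  have cA := hA.1.2.1
  have cD := hD.1.2.1
  have sA := hA.2.2.1
  have sD := hD.2.2.1
  simp only at cA cD sA sD
  have a1 := fun x y a => has (x, 0) (y, 0) (0, a)
  have a2 := fun a b x => has (0, a) (0, b) (x, 0)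
  have l1 := fun x y a => hl (x, 0) (y, 0) (0, a)
  have l2 := fun x y a => hl (0, a) (x, 0) (y, 0)
  have l3 := fun x a b => hl (0, a) (0, b) (x, 0)
  have l4 := fun x a b => hl (x, 0) (0, a) (0, b)
  simp only [sumMul, sumBr, map_zero, LinearMap.zero_apply, map_add, map_neg, map_sub, add_zero, zero_add,
    sub_zero, zero_sub, LinearMap.neg_apply, Prod.mk.injEq, Prod.mk_add_mk] at a1 a2 l1 l2 l3 l4
  refine ⟨hA, hD, bilin_lin r, bilin_lin u, bilin_lin s, bilin_lin v, ?_, ?_, ?_, ?_, ?_, ?_, ?_,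
    ?_, ?_, ?_, ?_, ?_⟩ <;> simp only
  · intro x y a
    exact (a1 x y a).2
  · intro x y a
    exact (a2 x y a).1
  · intro x a b
    have := (a2 b a x).2
    grind
  · intro a x y
    have := (a1 y x a).1
    grind
  · intro x y a
    have := (l2 x y a).2
    grind
  · intro x y a
    have := (l1 x y a).2
    grind
  · intro x y a
    have := (l4 a x y).1
    grind
  · intro x y a
    have := (l3 a x y).1
    grind
  · intro a x y
    have := (l2 x y a).1
    grind
  · intro x a b
    have := (l4 x a b).2
    grind
  · intro x a y
    have := (l1 x y a).1
    grind
  · intro x a y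
    have := (l3 a x y).2
    grind

theorem sum_of_matched (br m : A →ₗ[K] A →ₗ[K] A) (brD mD : B →ₗ[K] B →ₗ[K] B)
    (r u : A →ₗ[K] B →ₗ[K] B) (s v : B →ₗ[K] A →ₗ[K] A)
    (h : IsMatchedPair K (fun x y => br x y) (fun x y => m x y)
        (fun ξ η => brD ξ η) (fun ξ η => mD ξ η) (fun x y => r x y) (fun x y => u x y)
        (fun x y => s x y) (fun x y => v x y)) :
    IsAlmostPoisson K (sumBr br brD r s) (sumMul m mD u v) := by
  obtain ⟨⟨⟨_, cA, aA⟩, _, sA, lA⟩, ⟨⟨_, cD, aD⟩, _, sD, lD⟩, -, -, -, -, h1, h2, h3, h4, h5, h6,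
    h7, h8, h9, h10, h11, h12⟩ := h
  simp only at cA aA sA lA cD aD sD lD h1 h2 h3 h4 h5 h6 h7 h8 h9 h10 h11 h12
  refine ⟨⟨⟨?_, ?_, ?_, ?_⟩, ?_, ?_⟩, ⟨?_, ?_, ?_, ?_⟩, ?_, ?_⟩
  · rintro ⟨x, a⟩ ⟨y, b⟩ ⟨z, c⟩
    simp only [sumMul, Prod.mk_add_mk, map_add, LinearMap.add_apply, Prod.mk.injEq]
    constructor <;> abel
  · rintro k ⟨y, b⟩ ⟨z, c⟩
    simp [sumMul]
  · rintro ⟨x, a⟩ ⟨y, b⟩ ⟨z, c⟩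
    simp only [sumMul, Prod.mk_add_mk, map_add, LinearMap.add_apply, Prod.mk.injEq]
    constructor <;> abel
  · rintro k ⟨y, b⟩ ⟨z, c⟩
    simp [sumMul]
  · rintro ⟨y, b⟩ ⟨z, c⟩
    simp only [sumMul, Prod.mk.injEq, cA y z, cD b c]
    constructor <;> abel
  · rintro ⟨x, a⟩ ⟨y, b⟩ ⟨z, c⟩
    simp only [sumMul, map_add, LinearMap.add_apply, Prod.mk.injEq]
    constructor
    · rw [aA, h2, h4 c x y, h4 a y z, cA (v b x) z, cA (v c x) y, cA x]
      have e := h4 b x z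
      have e' := h4 b z x
      have e'' := h2 c a y
      have := h4 c y x
      have := h2 a c y
      have := h2 b c x
      have := h2 c b x
      grind
    · rw [aD, h1, h3 z a b, h3 x b c]
      have e := h3 y a c
      have e' := h3 y c a
      have := h3 z b a
      have := h1 x z b
      have := h1 z x b
      have := h1 y z a
      have := h1 z y a
      grind
  · rintro ⟨x, a⟩ ⟨y, b⟩ ⟨z, c⟩
    simp only [sumBr, Prod.mk_add_mk, map_add, LinearMap.add_apply, Prod.mk.injEq]
    constructor <;> abel
  · rintro k ⟨y, b⟩ ⟨z, c⟩
    simp [sumBr, smul_sub]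
  · rintro ⟨x, a⟩ ⟨y, b⟩ ⟨z, c⟩
    simp only [sumBr, Prod.mk_add_mk, map_add, LinearMap.add_apply, Prod.mk.injEq]
    constructor <;> abel
  · rintro k ⟨y, b⟩ ⟨z, c⟩
    simp [sumBr, smul_sub]
  · rintro ⟨y, b⟩ ⟨z, c⟩
    simp only [sumBr, Prod.mk.injEq, sA y z, sD b c, Prod.neg_mk]
    constructor <;> abel
  · rintro ⟨x, a⟩ ⟨y, b⟩ ⟨z, c⟩
    simp only [sumMul, sumBr, map_add, map_sub, LinearMap.sub_apply, LinearMap.add_apply,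
      Prod.mk_add_mk, Prod.mk.injEq]
    constructor
    · have e1 := lA x y z
      have e2 := h11 x b z
      have e3 := h11 x c y
      have e4 := h9 a y z
      have e5 := h8 a b z
      have e6 := h8 a c y
      have e7 := h7 b c x
      have := cA (s c x) y
      grind
    · have e1 := lD a b c
      have e2 := h12 a y c
      have e3 := h12 a z b
      have e4 := h10 x b c
      have e5 := h6 x y c
      have e6 := h6 x z b
      have e7 := h5 y z a
      have := cD (r z a) b
      grind

end helpers

/-- `(A ⊕ A*, A, A*)` is a standard Manin triple of almost Poisson algebras
(with respect to `ω_d(x+ξ, y+η) = ⟨x,η⟩ + ⟨ξ,y⟩`) iff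
`(A, A*, ad*, −L*, ad_{A*}*, −L_{A*}*)` is a matched pair of almost Poisson algebras. -/
theorem stmt3 {K A : Type*} [Field K] [CharZero K] [AddCommGroup A] [Module K A]
    [FiniteDimensional K A]
    (br m : A →ₗ[K] A →ₗ[K] A)
    (brD mD : Module.Dual K A →ₗ[K] Module.Dual K A →ₗ[K] Module.Dual K A)
    (hA : IsAlmostPoisson K (fun x y => br x y) (fun x y => m x y))
    (hD : IsAlmostPoisson K (fun ξ η => brD ξ η) (fun ξ η => mD ξ η)) :
    (∃ BR MM : (A × Module.Dual K A) → (A × Module.Dual K A) → (A × Module.Dual K A),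
      IsAlmostPoisson K BR MM ∧
      (∀ x y : A, BR (x, 0) (y, 0) = (br x y, 0)) ∧
      (∀ x y : A, MM (x, 0) (y, 0) = (m x y, 0)) ∧
      (∀ ξ η : Module.Dual K A, BR (0, ξ) (0, η) = (0, brD ξ η)) ∧
      (∀ ξ η : Module.Dual K A, MM (0, ξ) (0, η) = (0, mD ξ η)) ∧
      (∀ p q r : A × Module.Dual K A,
        (MM p q).2 r.1 + r.2 (MM p q).1 = p.2 (MM q r).1 + (MM q r).2 p.1) ∧
      (∀ p q r : A × Module.Dual K A,
        (BR p q).2 r.1 + r.2 (BR p q).1 = p.2 (BR q r).1 + (BR q r).2 p.1))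
    ↔ IsMatchedPair K (fun x y => br x y) (fun x y => m x y)
        (fun ξ η => brD ξ η) (fun ξ η => mD ξ η)
        (fun x ξ => -(ξ ∘ₗ br x)) (fun x ξ => ξ ∘ₗ m x)
        (fun ξ x =>
          -((Module.evalEquiv K A).symm ((brD ξ).dualMap (Module.evalEquiv K A x))))
        (fun ξ x =>
          (Module.evalEquiv K A).symm ((mD ξ).dualMap (Module.evalEquiv K A x))) := by
  let s : Module.Dual K A →ₗ[K] A →ₗ[K] A := LinearMap.mk₂ K (fun ξ x =>
          -((Module.evalEquiv K A).symm ((brD ξ).dualMap (Module.evalEquiv K A x))))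
    (by intro a b c; rw [← neg_add, ← map_add]; congr 2; ext; simp)
    (by intro a b c; rw [smul_neg, ← map_smul]; congr 2; ext; simp)
    (by intro a b c; simp [add_comm])
    (by intro a b c; simp)
  let v : Module.Dual K A →ₗ[K] A →ₗ[K] A := LinearMap.mk₂ K (fun ξ x =>
          ((Module.evalEquiv K A).symm ((mD ξ).dualMap (Module.evalEquiv K A x))))
    (by intro a b c; rw [← map_add]; congr 1; ext; simp)
    (by intro a b c; rw [← map_smul]; congr 1; ext; simp)
    (by intro a b c; simp)
    (by intro a b c; simp)
  let r : A →ₗ[K] Module.Dual K A →ₗ[K] Module.Dual K A :=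
    LinearMap.mk₂ K (fun x ξ => -(ξ ∘ₗ br x))
    (by intro a b c; ext; simp [add_comm])
    (by intro a b c; ext; simp)
    (by intro a b c; ext; simp [add_comm])
    (by intro a b c; ext; simp)
  let u : A →ₗ[K] Module.Dual K A →ₗ[K] Module.Dual K A :=
    LinearMap.mk₂ K (fun x ξ => (ξ ∘ₗ m x))
    (by intro a b c; ext; simp)
    (by intro a b c; ext; simp)
    (by intro a b c; ext; simp)
    (by intro a b c; ext; simp)
  have hs : ∀ ξ x (η : Module.Dual K A), η (s ξ x) = - (brD ξ η x) := by
    intro ξ x η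
    simp [s]
  have hv : ∀ ξ x (η : Module.Dual K A), η (v ξ x) = (mD ξ η x) := by
    intro ξ x η
    simp [v]
  have hr : ∀ x (ξ : Module.Dual K A) y, r x ξ y = - ξ (br x y) := by
    intro x ξ y; simp [r]
  have hu : ∀ x (ξ : Module.Dual K A) y, u x ξ y = ξ (m x y) := by
    intro x ξ y; simp [u]
  have cA : ∀ x y, m x y = m y x := hA.1.2.1
  have cD : ∀ x y, mD x y = mD y x := hD.1.2.1
  have sA : ∀ x y, br x y = - br y x := hA.2.2.1
  have sD : ∀ x y, brD x y = - brD y x := hD.2.2.1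
  change _ ↔ IsMatchedPair K (fun x y => br x y) (fun x y => m x y)
        (fun ξ η => brD ξ η) (fun ξ η => mD ξ η) (fun x y => r x y) (fun x y => u x y)
        (fun x y => s x y) (fun x y => v x y)
  clear_value s v r u
  constructor
  · rintro ⟨BR, MM, hP, b1, m1, b2, m2, im, ib⟩
    have hsep : ∀ x y : A, (∀ η : Module.Dual K A, η x = η y) → x = y := fun x y h =>
      (Module.evalEquiv K A).injective (by ext η; simpa using h η)
    obtain ⟨⟨⟨ma, -, ma', -⟩, mc, -⟩, ⟨ba, -, ba', -⟩, bs, -⟩ := id hP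
    have dec : ∀ p : A × Module.Dual K A, p = (p.1, 0) + (0, p.2) := by
      intro p; simp
    have hm : ∀ x a, MM (x, 0) (0, a) = (v a x, u x a) := by
      intro x a
      ext1
      · apply hsep
        intro η
        have := im (x, 0) (0, a) (0, η)
        rw [m2] at this
        rw [hv]
        simpa using this
      · ext y
        have := im (0, a) (x, 0) (y, 0)
        rw [m1, mc (0, a)] at this
        rw [hu]
        simpa using this
    have hb : ∀ x a, BR (x, 0) (0, a) = (- s a x, r x a) := by
      intro x a
      ext1
      · apply hsep
        intro η
        have := ib (x, 0) (0, a) (0, η)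
        rw [b2] at this
        rw [map_neg, hs]
        simpa using this
      · ext y
        have := ib (0, a) (x, 0) (y, 0)
        rw [b1, bs (0, a)] at this
        rw [hr, eq_neg_iff_add_eq_zero, ← neg_eq_zero]
        simp at this
        simp [← this]
    have hMM : MM = sumMul m mD u v := by
      funext p q
      conv_lhs => rw [dec p, dec q]
      rw [ma, ma', ma', m1, m2, hm, mc (0, p.2), hm]
      simp only [sumMul, Prod.mk_add_mk, Prod.mk.injEq]
      constructor <;> abel
    have hBR : BR = sumBr br brD r s := by
      funext p q
      conv_lhs => rw [dec p, dec q]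
      rw [ba, ba', ba', b1, b2, hb, bs (0, p.2), hb]
      simp only [sumBr, Prod.mk_add_mk, Prod.neg_mk, Prod.mk.injEq]
      constructor <;> abel
    rw [hMM, hBR] at hP
    exact matched_of_sum br m brD mD r u s v hA hD hP
  · intro h
    refine ⟨_, _, sum_of_matched br m brD mD r u s v h, ?_, ?_, ?_, ?_, ?_, ?_⟩
    · intro x y; simp [sumBr]
    · intro x y; simp [sumMul]
    · intro x y; simp [sumBr]
    · intro x y; simp [sumMul]
    · rintro ⟨x, a⟩ ⟨y, b⟩ ⟨z, c⟩
      simp only [sumMul, map_add, LinearMap.add_apply, hv, hu]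
      rw [cA z x, cA y x, cD b a, cD c a]
      ring
    · rintro ⟨x, a⟩ ⟨y, b⟩ ⟨z, c⟩
      simp only [sumBr, map_add, map_sub, LinearMap.add_apply, LinearMap.sub_apply, hs, hr]
      have e1 := congrArg a (sA z y)
      have e2 := congrArg b (sA z x)
      have e3 := congrArg c (sA y x)
      have e4 := LinearMap.congr_fun (sD c b) x
      have e5 := LinearMap.congr_fun (sD c a) y
      have e6 := LinearMap.congr_fun (sD b a) z
      simp only [map_neg, LinearMap.neg_apply] at e1 e2 e3 e4 e5 e6
      grind
end

section
/- Let (A,[·,·],·) and (V,[·,·]_V,·_V) be almost Poisson algebras and ϱ,μ : A → End(V) linear maps. Then (V,·_V,[·,·]_V,μ,ϱ) is an A-module almost Poisson algebra if and only if A ⊕ V equipped with the operations {x+a, y+b} = [x,y] + ϱ(x)b − ϱ(y)a + [a,b]_V and (x+a)•(y+b) = x·y + μ(x)b + μ(y)a + a·_V b, for x,y ∈ A and a,b ∈ V, is an almost Poisson algebra. -/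
/-- An `A`-module almost Poisson algebra `(V, mV, brV, μ, ϱ)` over `(A, br, m)`. -/
def IsModAP (K : Type*) [Field K] {A V : Type*} [AddCommGroup A] [Module K A]
    [AddCommGroup V] [Module K V] (br m : A → A → A) (brV mV : V → V → V)
    (μ ϱ : A → V → V) : Prop :=
  IsAlmostPoisson K brV mV ∧ IsBilin K μ ∧ IsBilin K ϱ ∧
  (∀ x y v, μ (m x y) v = μ x (μ y v)) ∧
  (∀ x y v, ϱ (m x y) v = μ y (ϱ x v) + μ x (ϱ y v)) ∧
  (∀ x y v, μ (br x y) v = ϱ x (μ y v) - μ y (ϱ x v)) ∧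
  (∀ x a b, μ x (mV a b) = mV (μ x a) b) ∧
  (∀ x a b, ϱ x (mV a b) = mV (ϱ x a) b + mV a (ϱ x b)) ∧
  (∀ x a b, brV a (μ x b) = - mV (ϱ x a) b + μ x (brV a b))

theorem bil_zl {K A B C : Type*} [Field K] [AddCommGroup A] [Module K A]
    [AddCommGroup B] [Module K B] [AddCommGroup C] [Module K C] {f : A → B → C}
    (h : IsBilin K f) (b : B) : f 0 b = 0 := by
  simpa using h.2.1 0 0 b

theorem bil_zr {K A B C : Type*} [Field K] [AddCommGroup A] [Module K A]
    [AddCommGroup B] [Module K B] [AddCommGroup C] [Module K C] {f : A → B → C}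
    (h : IsBilin K f) (a : A) : f a 0 = 0 := by
  simpa using h.2.2.2 0 a 0

theorem bil_sl {K A B C : Type*} [Field K] [AddCommGroup A] [Module K A]
    [AddCommGroup B] [Module K B] [AddCommGroup C] [Module K C] {f : A → B → C}
    (h : IsBilin K f) (a a' : A) (b : B) : f (a - a') b = f a b - f a' b := by
  rw [eq_sub_iff_add_eq, ← h.1, sub_add_cancel]

theorem bil_sr {K A B C : Type*} [Field K] [AddCommGroup A] [Module K A]
    [AddCommGroup B] [Module K B] [AddCommGroup C] [Module K C] {f : A → B → C}
    (h : IsBilin K f) (a : A) (b b' : B) : f a (b - b') = f a b - f a b' := by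
  rw [eq_sub_iff_add_eq, ← h.2.2.1, sub_add_cancel]

/-- `(V, mV, brV, μ, ϱ)` is an `A`-module almost Poisson algebra iff the
semi-direct product operations make `A ⊕ V` an almost Poisson algebra. -/
theorem stmt6 {K A V : Type*} [Field K] [CharZero K] [AddCommGroup A] [Module K A]
    [AddCommGroup V] [Module K V]
    (br m : A → A → A) (brV mV : V → V → V) (μ ϱ : A → V → V)
    (hA : IsAlmostPoisson K br m) (hV : IsAlmostPoisson K brV mV)
    (hμ : IsBilin K μ) (hϱ : IsBilin K ϱ) :
    IsModAP K br m brV mV μ ϱ ↔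
    IsAlmostPoisson K
      (fun p q : A × V => (br p.1 q.1, ϱ p.1 q.2 - ϱ q.1 p.2 + brV p.2 q.2))
      (fun p q : A × V => (m p.1 q.1, μ p.1 q.2 + μ q.1 p.2 + mV p.2 q.2)) := by
  obtain ⟨⟨bm, cm, am⟩, bbr, sbr, lbr⟩ := id hA
  obtain ⟨⟨bmV, cmV, amV⟩, bbrV, sbrV, lbrV⟩ := id hV
  constructor
  · rintro ⟨-, -, -, h1, h2, h3, h4, h5, h6⟩
    have h4' : ∀ x a b, mV a (μ x b) = μ x (mV a b) := by
      intro x a b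
      rw [cmV, ← h4, cmV]
    refine ⟨⟨⟨?_, ?_, ?_, ?_⟩, ?_, ?_⟩, ⟨?_, ?_, ?_, ?_⟩, ?_, ?_⟩
    · rintro ⟨x, a⟩ ⟨y, b⟩ ⟨z, c⟩
      ext
      · simp [bm.1]
      · simp only [Prod.mk_add_mk, hμ.1, hμ.2.2.1, bmV.1]; abel
    · rintro k ⟨x, a⟩ ⟨y, b⟩
      ext
      · simp [bm.2.1]
      · simp only [Prod.smul_mk, hμ.2.1, hμ.2.2.2, bmV.2.1, smul_add]
    · rintro ⟨x, a⟩ ⟨y, b⟩ ⟨z, c⟩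
      ext
      · simp [bm.2.2.1]
      · simp only [Prod.mk_add_mk, hμ.1, hμ.2.2.1, bmV.2.2.1]; abel
    · rintro k ⟨x, a⟩ ⟨y, b⟩
      ext
      · simp [bm.2.2.2]
      · simp only [Prod.smul_mk, hμ.2.1, hμ.2.2.2, bmV.2.2.2, smul_add]
    · rintro ⟨x, a⟩ ⟨y, b⟩
      ext
      · exact cm x y
      · simp only [cmV a b]; abel
    · rintro ⟨x, a⟩ ⟨y, b⟩ ⟨z, c⟩
      ext
      · exact am x y z
      · have e : μ z (μ x b) = μ x (μ z b) := by rw [← h1, ← h1, cm]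
        have e2 : μ z (μ y a) = μ y (μ z a) := by rw [← h1, ← h1, cm]
        simp only [hμ.2.2.1, bmV.1, bmV.2.2.1, h1, h4', ← h4, amV, e, e2]; abel
    · rintro ⟨x, a⟩ ⟨y, b⟩ ⟨z, c⟩
      ext
      · simp [bbr.1]
      · simp only [Prod.mk_add_mk, hϱ.1, hϱ.2.2.1, bbrV.1]; abel
    · rintro k ⟨x, a⟩ ⟨y, b⟩
      ext
      · simp [bbr.2.1]
      · simp only [Prod.smul_mk, hϱ.2.1, hϱ.2.2.2, bbrV.2.1, smul_add, smul_sub]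
    · rintro ⟨x, a⟩ ⟨y, b⟩ ⟨z, c⟩
      ext
      · simp [bbr.2.2.1]
      · simp only [Prod.mk_add_mk, hϱ.1, hϱ.2.2.1, bbrV.2.2.1]; abel
    · rintro k ⟨x, a⟩ ⟨y, b⟩
      ext
      · simp [bbr.2.2.2]
      · simp only [Prod.smul_mk, hϱ.2.1, hϱ.2.2.2, bbrV.2.2.2, smul_add, smul_sub]
    · rintro ⟨x, a⟩ ⟨y, b⟩
      ext
      · exact sbr x y
      · simp only [Prod.snd_neg, sbrV a b]; abel
    · rintro ⟨x, a⟩ ⟨y, b⟩ ⟨z, c⟩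
      ext
      · exact lbr x y z
      · simp only [Prod.snd_add, hμ.2.2.1, hϱ.2.2.1, bil_sr hμ, bmV.1, bmV.2.2.1, bbrV.2.2.1,
          bil_sl bmV, bil_sr bmV, h2, h3, h5, h6, lbrV, cmV b (ϱ z a)]
        abel
  · rintro ⟨⟨-, -, as⟩, -, -, lb⟩
    have z1 := bil_zl hμ
    have z2 := bil_zr hμ
    have z3 := bil_zl hϱ
    have z4 := bil_zr hϱ
    have z5 := bil_zl bmV
    have z6 := bil_zr bmV
    have z7 := bil_zl bbrV
    have z8 := bil_zr bbrV
    have z9 := bil_zl bm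
    have z10 := bil_zr bm
    have z11 := bil_zl bbr
    have z12 := bil_zr bbr
    refine ⟨hV, hμ, hϱ, ?_, ?_, ?_, ?_, ?_, ?_⟩
    · intro x y v
      have := congrArg Prod.snd (as (x, 0) (y, 0) (0, v))
      simpa [z1, z2, z3, z4, z5, z6, z7, z8, z9, z10, z11, z12] using this
    · intro x y v
      have := congrArg Prod.snd (lb (0, v) (x, 0) (y, 0))
      simp only [Prod.snd_add, z1, z2, z3, z4, z5, z6, z7, z8, z9, z10, z11, z12,
        add_zero, zero_add, sub_zero, zero_sub] at this
      rw [← neg_inj, this, ← zero_sub, ← zero_sub (ϱ y v), bil_sr hμ, bil_sr hμ, z2, z2]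
      abel
    · intro x y v
      have := congrArg Prod.snd (lb (x, 0) (y, 0) (0, v))
      simp only [Prod.snd_add, z1, z2, z3, z4, z5, z6, z7, z8, z9, z10, z11, z12,
        add_zero, zero_add, sub_zero, zero_sub] at this
      rw [this]; abel
    · intro x a b
      have := congrArg Prod.snd (as (x, 0) (0, a) (0, b))
      simp only [z1, z2, z3, z4, z5, z6, z7, z8, z9, z10, z11, z12,
        add_zero, zero_add] at this
      exact this.symm
    · intro x a b
      have := congrArg Prod.snd (lb (x, 0) (0, a) (0, b))
      simpa [z1, z2, z3, z4, z5, z6, z7, z8, z9, z10, z11, z12] using this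
    · intro x a b
      have := congrArg Prod.snd (lb (0, a) (x, 0) (0, b))
      simp only [Prod.snd_add, z1, z2, z3, z4, z5, z6, z7, z8, z9, z10, z11, z12,
        add_zero, zero_add, sub_zero, zero_sub] at this
      rw [this, ← zero_sub (ϱ x a), bil_sl bmV, z5, zero_sub]
end

section
/- Let (A,·,{·,·}) be an algebra with bracket (AWB), V a vector space, and l,r,L,R : A → End(V) linear maps. Then (V,l,r,L,R) is a representation of the AWB (A,·,{·,·}) if and only if A ⊕ V with the operations (x+u)·(y+v) = x·y + l(x)v + r(y)u and {x+u, y+v} = {x,y} + L(x)v + R(y)u is an AWB. -/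
def IsAssocOp (K : Type*) [Field K] {A : Type*} [AddCommGroup A] [Module K A]
    (m : A → A → A) : Prop :=
  IsBilin K m ∧ ∀ x y z, m (m x y) z = m x (m y z)

/-- An algebra with bracket: associative product `m` and bracket `br` with the
Leibniz-type compatibility. -/
def IsAWB (K : Type*) [Field K] {A : Type*} [AddCommGroup A] [Module K A]
    (m br : A → A → A) : Prop :=
  IsAssocOp K m ∧ IsBilin K br ∧ ∀ x y z, br x (m y z) = m (br x y) z + m y (br x z)

/-- Representation of an algebra with bracket. -/
def IsAWBRep (K : Type*) [Field K] {A V : Type*} [AddCommGroup A] [Module K A]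
    [AddCommGroup V] [Module K V] (m br : A → A → A) (l r L R : A → V → V) : Prop :=
  IsBilin K l ∧ IsBilin K r ∧ IsBilin K L ∧ IsBilin K R ∧
  (∀ x y v, l (m x y) v = l x (l y v)) ∧
  (∀ x y v, r (m x y) v = r y (r x v)) ∧
  (∀ x y v, l x (r y v) = r y (l x v)) ∧
  (∀ x y v, L x (l y v) = l (br x y) v + l y (L x v)) ∧
  (∀ x y v, L x (r y v) = r y (L x v) + r (br x y) v) ∧
  (∀ x y v, R (m x y) v = r y (R x v) + l x (R y v))

/-- `(V, l, r, L, R)` is a representation of the AWB `(A, ·, {·,·})` iff the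
semi-direct product operations make `A ⊕ V` an AWB. -/
theorem stmt12 {K A V : Type*} [Field K] [CharZero K] [AddCommGroup A] [Module K A]
    [AddCommGroup V] [Module K V]
    (m br : A → A → A) (l r L R : A → V → V)
    (hA : IsAWB K m br)
    (hl : IsBilin K l) (hr : IsBilin K r) (hL : IsBilin K L) (hR : IsBilin K R) :
    IsAWBRep K m br l r L R ↔
    IsAWB K (fun p q : A × V => (m p.1 q.1, l p.1 q.2 + r q.1 p.2))
      (fun p q : A × V => (br p.1 q.1, L p.1 q.2 + R q.1 p.2)) := by
  obtain ⟨⟨⟨m1, m2, m3, m4⟩, ma⟩, ⟨b1, b2, b3, b4⟩, bm⟩ := hA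
  have hl' := hl
  have hr' := hr
  have hL' := hL
  have hR' := hR
  obtain ⟨l1, l2, l3, l4⟩ := hl
  obtain ⟨r1, r2, r3, r4⟩ := hr
  obtain ⟨L1, L2, L3, L4⟩ := hL
  obtain ⟨R1, R2, R3, R4⟩ := hR
  have l0 : ∀ x, l x 0 = 0 := fun x => by simpa using l4 0 x 0
  have r0 : ∀ x, r x 0 = 0 := fun x => by simpa using r4 0 x 0
  have L0 : ∀ x, L x 0 = 0 := fun x => by simpa using L4 0 x 0
  have R0 : ∀ x, R x 0 = 0 := fun x => by simpa using R4 0 x 0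
  constructor
  · rintro ⟨-, -, -, -, h1, h2, h3, h4, h5, h6⟩
    refine ⟨⟨⟨?_, ?_, ?_, ?_⟩, ?_⟩, ⟨?_, ?_, ?_, ?_⟩, ?_⟩
    · rintro ⟨a, u⟩ ⟨b, v⟩ ⟨c, w⟩
      simp only [Prod.mk_add_mk, m1, l1, r3, Prod.mk.injEq, true_and]; abel
    · rintro k ⟨a, u⟩ ⟨b, v⟩
      simp only [Prod.smul_mk, m2, l2, r4, smul_add]
    · rintro ⟨a, u⟩ ⟨b, v⟩ ⟨c, w⟩
      simp only [Prod.mk_add_mk, m3, l3, r1, Prod.mk.injEq, true_and]; abel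
    · rintro k ⟨a, u⟩ ⟨b, v⟩
      simp only [Prod.smul_mk, m4, l4, r2, smul_add]
    · rintro ⟨a, u⟩ ⟨b, v⟩ ⟨c, w⟩
      simp only [ma, l3, r3, h1, h2, h3, Prod.mk.injEq, true_and]; abel
    · rintro ⟨a, u⟩ ⟨b, v⟩ ⟨c, w⟩
      simp only [Prod.mk_add_mk, b1, L1, R3, Prod.mk.injEq, true_and]; abel
    · rintro k ⟨a, u⟩ ⟨b, v⟩
      simp only [Prod.smul_mk, b2, L2, R4, smul_add]
    · rintro ⟨a, u⟩ ⟨b, v⟩ ⟨c, w⟩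
      simp only [Prod.mk_add_mk, b3, L3, R1, Prod.mk.injEq, true_and]; abel
    · rintro k ⟨a, u⟩ ⟨b, v⟩
      simp only [Prod.smul_mk, b4, L4, R2, smul_add]
    · rintro ⟨a, u⟩ ⟨b, v⟩ ⟨c, w⟩
      simp only [Prod.mk_add_mk, bm, l3, r3, L3, h4, h5, h6, Prod.mk.injEq, true_and]; abel
  · rintro ⟨⟨-, as⟩, -, lb⟩
    refine ⟨hl', hr', hL', hR', ?_, ?_, ?_, ?_, ?_, ?_⟩
    · intro x y v
      simpa [l0, r0, L0, R0] using congrArg Prod.snd (as (x, 0) (y, 0) (0, v))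
    · intro x y v
      simpa [l0, r0, L0, R0] using (congrArg Prod.snd (as (0, v) (x, 0) (y, 0))).symm
    · intro x y v
      simpa [l0, r0, L0, R0] using (congrArg Prod.snd (as (x, 0) (0, v) (y, 0))).symm
    · intro x y v
      simpa [l0, r0, L0, R0] using congrArg Prod.snd (lb (x, 0) (y, 0) (0, v))
    · intro x y v
      simpa [l0, r0, L0, R0] using congrArg Prod.snd (lb (x, 0) (0, v) (y, 0))
    · intro x y v
      simpa [l0, r0, L0, R0] using congrArg Prod.snd (lb (0, v) (x, 0) (y, 0))
end

section
/- Let (A,·) be a commutative associative algebra and (V,μ) a representation of it. A linear map K : V → A is a relative averaging operator on (A,·) with respect to (V,μ) if and only if the map N_K : A ⊕ V → A ⊕ V, N_K(x+u) = K(u), is a Nijenhuis operator on the hemisemi-direct product associative algebra A ⊕_μ V with product (x+u)·(y+v) = x·y + μ(x)v. -/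
/-- A Nijenhuis operator on an associative algebra. -/
def IsNijenhuisAssoc (K : Type*) [Field K] {A : Type*} [AddCommGroup A] [Module K A]
    (m : A → A → A) (N : A → A) : Prop :=
  IsLinearMap K N ∧ ∀ a b, m (N a) (N b) = N (m (N a) b + m a (N b) - N (m a b))

/-- `T` is a relative averaging operator iff `N_T(x+u) = T(u)` is a
Nijenhuis operator on the hemisemi-direct product `A ⊕_μ V`. -/
theorem stmt14 {K A V : Type*} [Field K] [CharZero K] [AddCommGroup A] [Module K A]
    [AddCommGroup V] [Module K V]
    (m : A → A → A) (μ : A → V → V)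
    (hm : IsCommAssoc K m) (hμ : IsBilin K μ)
    (hrep : ∀ x y v, μ (m x y) v = μ x (μ y v))
    (T : V → A) (hT : IsLinearMap K T) :
    (∀ u v, m (T u) (T v) = T (μ (T u) v)) ↔
    IsNijenhuisAssoc K (fun p q : A × V => (m p.1 q.1, μ p.1 q.2))
      (fun p : A × V => (T p.2, 0)) := by
  have h0 : ∀ x, μ x 0 = 0 := fun x => by
    have := hμ.2.2.2 0 x 0
    simpa using this
  constructor
  · intro h
    refine ⟨⟨?_, ?_⟩, ?_⟩
    · intro p q
      ext <;> simp [hT.map_add]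
    · intro c p
      ext <;> simp [hT.map_smul]
    · intro a b
      ext <;> simp [h0, h]
  · intro h u v
    have := congrArg Prod.fst (h.2 (0, u) (0, v))
    simpa [h0] using this
end

section
/- Let K : V → A be a relative averaging operator on a commutative associative algebra (A,·) with respect to a representation (V,μ). Then the operation u ·_K v = μ(K(u))v makes V an associative algebra. -/
/-- a relative averaging operator `T` induces an associative product
`u ·_T v = μ(T(u))v` on `V`. -/
theorem stmt15 {K A V : Type*} [Field K] [CharZero K] [AddCommGroup A] [Module K A]
    [AddCommGroup V] [Module K V]
    (m : A → A → A) (μ : A → V → V)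
    (hm : IsCommAssoc K m) (hμ : IsBilin K μ)
    (hrep : ∀ x y v, μ (m x y) v = μ x (μ y v))
    (T : V → A) (hT : IsLinearMap K T)
    (havg : ∀ u v, m (T u) (T v) = T (μ (T u) v)) :
    IsAssocOp K (fun u v => μ (T u) v) := by
  obtain ⟨h1, h2, h3, h4⟩ := hμ
  refine ⟨⟨fun a a' b => ?_, fun c a b => ?_, fun a b b' => h3 _ _ _, fun c a b => h4 _ _ _⟩,
    fun x y z => ?_⟩
  · show μ (T (a + a')) b = _
    rw [hT.map_add, h1]
  · show μ (T (c • a)) b = _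
    rw [hT.map_smul, h2]
  · show μ (T (μ (T x) y)) z = μ (T x) (μ (T y) z)
    rw [← havg, hrep]
end

section
/- Let (A,[·,·],·) be an almost Poisson algebra and (V,μ,ρ) a representation of A. Then A ⊕ V with the operations (x+u)·(y+v) = x·y + μ(x)v and {x+u, y+v} = [x,y] + ρ(x)v is an algebra with bracket (AWB), called the hemisemi-direct product A ⊕_{μ,ρ} V. -/
/-- A representation `(V, ϱ, μ)` of an almost Poisson algebra `(A, br, m)`. -/
def IsAPRep (K : Type*) [Field K] {A V : Type*} [AddCommGroup A] [Module K A]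
    [AddCommGroup V] [Module K V] (br m : A → A → A) (ϱ μ : A → V → V) : Prop :=
  IsBilin K ϱ ∧ IsBilin K μ ∧
  (∀ x y v, μ (m x y) v = μ x (μ y v)) ∧
  (∀ x y v, ϱ (m x y) v = μ y (ϱ x v) + μ x (ϱ y v)) ∧
  (∀ x y v, μ (br x y) v = ϱ x (μ y v) - μ y (ϱ x v))

/-- the hemisemi-direct product `A ⊕_{μ,ρ} V` of an almost Poisson algebra
with a representation is an algebra with bracket. -/
theorem stmt16 {K A V : Type*} [Field K] [CharZero K] [AddCommGroup A] [Module K A]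
    [AddCommGroup V] [Module K V]
    (br m : A → A → A) (ρ μ : A → V → V)
    (hA : IsAlmostPoisson K br m) (hrep : IsAPRep K br m ρ μ) :
    IsAWB K (fun p q : A × V => (m p.1 q.1, μ p.1 q.2))
      (fun p q : A × V => (br p.1 q.1, ρ p.1 q.2)) := by
  obtain ⟨⟨hm, -, hassoc⟩, hbr, -, hleib⟩ := hA
  obtain ⟨hρ, hμ, h1, -, h3⟩ := hrep
  have key : ∀ (f : A → A → A) (g : A → V → V), IsBilin K f → IsBilin K g →
      IsBilin K (fun p q : A × V => (f p.1 q.1, g p.1 q.2)) := by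
    rintro f g ⟨f1, f2, f3, f4⟩ ⟨g1, g2, g3, g4⟩
    exact ⟨fun a a' b => Prod.ext (f1 _ _ _) (g1 _ _ _),
      fun c a b => Prod.ext (f2 _ _ _) (g2 _ _ _),
      fun a b b' => Prod.ext (f3 _ _ _) (g3 _ _ _),
      fun c a b => Prod.ext (f4 _ _ _) (g4 _ _ _)⟩
  refine ⟨⟨key m μ hm hμ, fun x y z => Prod.ext (hassoc _ _ _) (h1 _ _ _)⟩,
    key br ρ hbr hρ, fun x y z => Prod.ext (hleib _ _ _) ?_⟩
  show ρ x.1 (μ y.1 z.2) = μ (br x.1 y.1) z.2 + μ y.1 (ρ x.1 z.2)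
  rw [h3, sub_add_cancel]
end

section
/- Let (A,[·,·],·) be an almost Poisson algebra and (V,μ,ρ) a representation of A. A linear map K : V → A is a relative averaging operator on the almost Poisson algebra (A,[·,·],·) with respect to (V,μ,ρ) if and only if the map N_K : A ⊕ V → A ⊕ V, N_K(x+u) = K(u), is a Nijenhuis operator on the hemisemi-direct product AWB A ⊕_{μ,ρ} V, whose operations are (x+u)·(y+v) = x·y + μ(x)v and {x+u, y+v} = [x,y] + ρ(x)v. -/
/-- A Nijenhuis operator on an algebra with bracket. -/
def IsNijenhuisAWB (K : Type*) [Field K] {A : Type*} [AddCommGroup A] [Module K A]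
    (m br : A → A → A) (N : A → A) : Prop :=
  IsLinearMap K N ∧
  (∀ a b, m (N a) (N b) = N (m (N a) b + m a (N b) - N (m a b))) ∧
  (∀ a b, br (N a) (N b) = N (br (N a) b + br a (N b) - N (br a b)))

/-- `T` is a relative averaging operator on the almost Poisson algebra `A`
iff `N_T(x+u) = T(u)` is a Nijenhuis operator on the hemisemi-direct product AWB. -/
theorem stmt18 {K A V : Type*} [Field K] [CharZero K] [AddCommGroup A] [Module K A]
    [AddCommGroup V] [Module K V]
    (br m : A → A → A) (ρ μ : A → V → V)
    (hA : IsAlmostPoisson K br m) (hrep : IsAPRep K br m ρ μ)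
    (T : V → A) (hT : IsLinearMap K T) :
    ((∀ u v, m (T u) (T v) = T (μ (T u) v)) ∧
     (∀ u v, br (T u) (T v) = T (ρ (T u) v))) ↔
    IsNijenhuisAWB K (fun p q : A × V => (m p.1 q.1, μ p.1 q.2))
      (fun p q : A × V => (br p.1 q.1, ρ p.1 q.2))
      (fun p : A × V => (T p.2, 0)) := by
  have hμ : ∀ x, μ x 0 = 0 := fun x => by
    have h := hrep.2.1.2.2.2 0 x 0
    simpa using h
  have hρ : ∀ x, ρ x 0 = 0 := fun x => by
    have h := hrep.1.2.2.2 0 x 0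
    simpa using h
  constructor
  · rintro ⟨h1, h2⟩
    refine ⟨⟨?_, ?_⟩, ?_, ?_⟩
    · intro x y
      simp [hT.map_add]
    · intro c x
      simp [hT.map_smul]
    · intro a b
      simp [hμ, h1]
    · intro a b
      simp [hρ, h2]
  · rintro ⟨-, h1, h2⟩
    refine ⟨fun u v => ?_, fun u v => ?_⟩
    · have h := congrArg Prod.fst (h1 (0, u) (0, v))
      simpa [hμ] using h
    · have h := congrArg Prod.fst (h2 (0, u) (0, v))
      simpa [hρ] using h
end

section
/- Let K : V → A be a relative averaging operator on an almost Poisson algebra (A,[·,·],·) with respect to a representation (V,μ,ρ). Then V carries an algebra with bracket (AWB) structure given by u ·_K v = μ(K(u))v and {u,v}_K = ρ(K(u))v for all u,v ∈ V; that is, (V, ·_K) is an associative algebra and {u, v ·_K w}_K = {u,v}_K ·_K w + v ·_K {u,w}_K for all u,v,w ∈ V. -/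
/-- a relative averaging operator on an almost Poisson algebra induces an
algebra-with-bracket structure on `V`. -/
theorem stmt19 {K A V : Type*} [Field K] [CharZero K] [AddCommGroup A] [Module K A]
    [AddCommGroup V] [Module K V]
    (br m : A → A → A) (ρ μ : A → V → V)
    (hA : IsAlmostPoisson K br m) (hrep : IsAPRep K br m ρ μ)
    (T : V → A) (hT : IsLinearMap K T)
    (havg1 : ∀ u v, m (T u) (T v) = T (μ (T u) v))
    (havg2 : ∀ u v, br (T u) (T v) = T (ρ (T u) v)) :
    IsAWB K (fun u v => μ (T u) v) (fun u v => ρ (T u) v) := by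
  obtain ⟨⟨r1, r2, r3, r4⟩, ⟨m1, m2, m3, m4⟩, h1, h2, h3⟩ := hrep
  refine ⟨⟨⟨?_, ?_, ?_, ?_⟩, ?_⟩, ⟨?_, ?_, ?_, ?_⟩, ?_⟩
  · intro a a' b
    simp only [hT.map_add, m1]
  · intro c a b
    simp only [hT.map_smul, m2]
  · intro a b b'
    exact m3 _ _ _
  · intro c a b
    exact m4 _ _ _
  · intro x y z
    simp only [← havg1, h1]
  · intro a a' b
    simp only [hT.map_add, r1]
  · intro c a b
    simp only [hT.map_smul, r2]
  · intro a b b'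
    exact r3 _ _ _
  · intro c a b
    exact r4 _ _ _
  · intro x y z
    simp only [← havg2, h3, sub_add_cancel]
end
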